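/- arXiv:2510.01067 — 5 statements merged into one kernel-verified Lean document; each statement's English description precedes it below -/
import Mathlib

section
/- Fix reals γ_h, γ_u, γ_v, γ_Q > 0, sequences H, U, V : ℕ → ℂ with |H_i| ≤ γ_h, |U_i| ≤ γ_u, |V_i| ≤ γ_v for all i, and a sequence of bounds γ_i ∈ (0, γ_Q]. For each n and each Q ∈ 𝒬^α(n), and each M ≤ n, the M×M top-left truncation of (1/n)𝟙𝟙^⊤Φ(Q) (whose (i,j) entry is (1/n)Σ_{k=1}^n Φ(Q)_{kj}) has ℓ²→ℓ² operator norm at most √M(γ_h + (1+α)γ_Q γ_u γ_v)/√n. Consequently, if α = α(n) is a function of n with α(n)/√n → 0, then for each fixed M the operator norm of this truncation tends to 0 as n → ∞, uniformly over Q ∈ 𝒬^{α(n)}(n). -/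
/-- The ℓ²→ℓ² operator norm of a complex matrix. -/
noncomputable def l2opNorm {m n : Type*} [Fintype m] [Fintype n] [DecidableEq n]
    (A : Matrix m n ℂ) : ℝ :=
  ‖LinearMap.toContinuousLinearMap (Matrix.toEuclideanLin A)‖

/-- The constraint set `𝒬^α(n)`: α-column diagonally dominant matrices with
`|Q_{ii}| ≤ γ i`. -/
def QSet (n : ℕ) (α : ℝ) (γ : ℕ → ℝ) : Set (Matrix (Fin n) (Fin n) ℂ) :=
  {Q | (∀ j, ∑ i ∈ Finset.univ.erase j, ‖Q i j‖ ≤ α * ‖Q j j‖) ∧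
       ∀ i, ‖Q i i‖ ≤ γ (i : ℕ)}

/-- The closed-loop map `Φ(Q) = diag H − diag U ⬝ Q ⬝ diag V`. -/
noncomputable def PhiMat (n : ℕ) (H U V : ℕ → ℂ) (Q : Matrix (Fin n) (Fin n) ℂ) :
    Matrix (Fin n) (Fin n) ℂ :=
  Matrix.diagonal (fun i : Fin n => H i) -
    Matrix.diagonal (fun i : Fin n => U i) * Q * Matrix.diagonal (fun i : Fin n => V i)

/-- The averaging matrix `(1/n) 𝟙𝟙ᵀ A`: each row equals the vector of column averages. -/
noncomputable def avgMat (n : ℕ) (A : Matrix (Fin n) (Fin n) ℂ) : Matrix (Fin n) (Fin n) ℂ :=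
  (((n : ℂ)⁻¹) • Matrix.of (fun _ _ : Fin n => (1 : ℂ))) * A

theorem l2opNorm_le_of_entries {M : ℕ} (A : Matrix (Fin M) (Fin M) ℂ) (c : ℝ) (hc : 0 ≤ c)
    (hA : ∀ i j, ‖A i j‖ ≤ c) : l2opNorm A ≤ M * c := by
  unfold l2opNorm
  refine ContinuousLinearMap.opNorm_le_bound _ (by positivity) fun x => ?_
  have h1 : ∀ i, ‖(Matrix.toEuclideanLin A x) i‖ ≤ c * ∑ j, ‖x j‖ := by
    intro i
    have : (Matrix.toEuclideanLin A x) i = ∑ j, A i j * x j := by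
      simp [Matrix.toLpLin_apply, Matrix.mulVec, dotProduct]
    rw [this, Finset.mul_sum]
    refine (norm_sum_le _ _).trans (Finset.sum_le_sum fun j _ => ?_)
    rw [norm_mul]
    exact mul_le_mul_of_nonneg_right (hA i j) (norm_nonneg _)
  have h2 : (∑ j, ‖x j‖) ^ 2 ≤ M * ∑ j, ‖x j‖ ^ 2 := by
    simpa using sq_sum_le_card_mul_sum_sq (s := (Finset.univ : Finset (Fin M)))
      (f := fun j => ‖x j‖)
  have h3 : ‖Matrix.toEuclideanLin A x‖ ^ 2 ≤ (M * c * ‖x‖) ^ 2 := by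
    rw [EuclideanSpace.norm_sq_eq, mul_pow, EuclideanSpace.norm_sq_eq x]
    calc ∑ i, ‖(Matrix.toEuclideanLin A x) i‖ ^ 2
        ≤ ∑ _i : Fin M, (c * ∑ j, ‖x j‖) ^ 2 :=
          Finset.sum_le_sum fun i _ => pow_le_pow_left₀ (norm_nonneg _) (h1 i) 2
      _ = M * c ^ 2 * (∑ j, ‖x j‖) ^ 2 := by simp; ring
      _ ≤ M * c ^ 2 * (M * ∑ j, ‖x j‖ ^ 2) := mul_le_mul_of_nonneg_left h2 (by positivity)
      _ = _ := by ring
  exact (pow_le_pow_iff_left₀ (norm_nonneg _) (by positivity) two_ne_zero).1 h3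

theorem avg_entry_bound
    (γh γu γv γQ : ℝ) (hγh : 0 < γh) (hγu : 0 < γu) (hγv : 0 < γv)
    (H U V : ℕ → ℂ)
    (hH : ∀ i, ‖H i‖ ≤ γh) (hU : ∀ i, ‖U i‖ ≤ γu)
    (hV : ∀ i, ‖V i‖ ≤ γv)
    (γ : ℕ → ℝ) (hγQ' : ∀ i, γ i ≤ γQ) (n : ℕ) (α : ℝ) (hα : 0 ≤ α)
    (Q : Matrix (Fin n) (Fin n) ℂ) (hQ : Q ∈ QSet n α γ) (i j : Fin n) :
    ‖avgMat n (PhiMat n H U V Q) i j‖ ≤ (γh + (1 + α) * γQ * γu * γv) / n := by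
  obtain ⟨hd, hb⟩ := hQ
  have e : avgMat n (PhiMat n H U V Q) i j
      = (n : ℂ)⁻¹ * (H j - ∑ k : Fin n, U k * Q k j * V j) := by
    simp [avgMat, PhiMat, Matrix.mul_apply, Matrix.diagonal_apply, ← Finset.mul_sum]
  have hs : ∑ k, ‖Q k j‖ ≤ (1 + α) * γQ := by
    rw [← Finset.add_sum_erase _ _ (Finset.mem_univ j)]
    have h1 := hd j
    have h2 : ‖Q j j‖ ≤ γQ := (hb j).trans (hγQ' j)
    nlinarith
  have h3 : ‖∑ k : Fin n, U k * Q k j * V j‖ ≤ γu * γv * ∑ k, ‖Q k j‖ := by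
    rw [Finset.mul_sum]
    refine (norm_sum_le _ _).trans (Finset.sum_le_sum fun k _ => ?_)
    rw [norm_mul, norm_mul]
    calc ‖U k‖ * ‖Q k j‖ * ‖V j‖ ≤ γu * ‖Q k j‖ * γv := by
          gcongr
          · exact hU k
          · exact hV j
      _ = _ := by ring
  have h4 : γu * γv * ∑ k, ‖Q k j‖ ≤ γu * γv * ((1 + α) * γQ) :=
    mul_le_mul_of_nonneg_left hs (by positivity)
  have h5 := norm_sub_le (H j) (∑ k : Fin n, U k * Q k j * V j)
  have h6 := hH j
  rw [e, norm_mul, norm_inv, Complex.norm_natCast, div_eq_inv_mul]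
  refine mul_le_mul_of_nonneg_left ?_ (by positivity)
  linarith

/-- the `M × M` truncation of `(1/n) 𝟙𝟙ᵀ Φ(Q)` has operator norm at most
`√M (γh + (1+α) γQ γu γv) / √n` for every `Q ∈ 𝒬^α(n)`; consequently, if `α(n)/√n → 0`
then for each fixed `M` this norm tends to `0` as `n → ∞` uniformly over `Q ∈ 𝒬^{α(n)}(n)`. -/
theorem truncated_ensemble_average_bound
    (γh γu γv γQ : ℝ) (hγh : 0 < γh) (hγu : 0 < γu) (hγv : 0 < γv) (hγQ : 0 < γQ)
    (H U V : ℕ → ℂ)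
    (hH : ∀ i, ‖H i‖ ≤ γh) (hU : ∀ i, ‖U i‖ ≤ γu)
    (hV : ∀ i, ‖V i‖ ≤ γv)
    (γ : ℕ → ℝ) (hγ : ∀ i, 0 < γ i) (hγQ' : ∀ i, γ i ≤ γQ) :
    (∀ (n M : ℕ) (hMn : M ≤ n) (α : ℝ), 0 ≤ α → ∀ Q ∈ QSet n α γ,
        l2opNorm ((avgMat n (PhiMat n H U V Q)).submatrix (Fin.castLE hMn) (Fin.castLE hMn)) ≤
          Real.sqrt M * (γh + (1 + α) * γQ * γu * γv) / Real.sqrt n) ∧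
    (∀ α : ℕ → ℝ, (∀ n, 0 ≤ α n) →
        Filter.Tendsto (fun n => α n / Real.sqrt n) Filter.atTop (nhds 0) →
        ∀ M : ℕ, ∀ ε > (0 : ℝ), ∃ N : ℕ, ∀ n ≥ N, ∀ (hMn : M ≤ n), ∀ Q ∈ QSet n (α n) γ,
          l2opNorm ((avgMat n (PhiMat n H U V Q)).submatrix (Fin.castLE hMn) (Fin.castLE hMn))
            ≤ ε) := by
  have main : ∀ (n M : ℕ) (hMn : M ≤ n) (α : ℝ), 0 ≤ α → ∀ Q ∈ QSet n α γ,
        l2opNorm ((avgMat n (PhiMat n H U V Q)).submatrix (Fin.castLE hMn) (Fin.castLE hMn)) ≤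
          Real.sqrt M * (γh + (1 + α) * γQ * γu * γv) / Real.sqrt n := by
    intro n M hMn α hα Q hQ
    have hC : 0 ≤ γh + (1 + α) * γQ * γu * γv := by positivity
    refine (l2opNorm_le_of_entries _ ((γh + (1 + α) * γQ * γu * γv) / n) (by positivity)
      fun i j => avg_entry_bound γh γu γv γQ hγh hγu hγv H U V hH hU hV γ hγQ' n α hα Q hQ _ _).trans
      ?_
    rcases Nat.eq_zero_or_pos n with h0 | hn
    · subst h0; simp
    have hn' : (0 : ℝ) < Real.sqrt n := Real.sqrt_pos.2 (by exact_mod_cast hn)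
    have hle : Real.sqrt M ≤ Real.sqrt n := Real.sqrt_le_sqrt (by exact_mod_cast hMn)
    have hM2 := Real.mul_self_sqrt (Nat.cast_nonneg (α := ℝ) M)
    have hn2 := Real.mul_self_sqrt (Nat.cast_nonneg (α := ℝ) n)
    have hM0 := Real.sqrt_nonneg (M : ℝ)
    generalize γh + (1 + α) * γQ * γu * γv = C at hC ⊢
    rw [← hM2, ← hn2]
    simp only [Real.sqrt_mul_self hM0, Real.sqrt_mul_self hn'.le]
    generalize Real.sqrt (M : ℝ) = m at *
    generalize Real.sqrt (n : ℝ) = r at *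
    have : m * m * (C / (r * r)) = m * C / r * (m / r) := by field_simp
    rw [this]
    exact mul_le_of_le_one_right (by positivity) ((div_le_one hn').2 hle)
  refine ⟨main, ?_⟩
  intro α hα hlim M ε hε
  have hinv : Filter.Tendsto (fun n : ℕ => (Real.sqrt n)⁻¹) Filter.atTop (nhds 0) :=
    (Real.tendsto_sqrt_atTop.comp tendsto_natCast_atTop_atTop).inv_tendsto_atTop
  have hT : Filter.Tendsto (fun n : ℕ => Real.sqrt M * (γh + (1 + α n) * γQ * γu * γv) / Real.sqrt n)
      Filter.atTop (nhds 0) := by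
    have h := (hinv.const_mul (Real.sqrt M * (γh + γQ * γu * γv))).add
      (hlim.const_mul (Real.sqrt M * (γQ * γu * γv)))
    simp only [mul_zero, add_zero] at h
    refine h.congr fun n => ?_
    simp only [div_eq_mul_inv]
    ring
  obtain ⟨N, hN⟩ := Filter.eventually_atTop.1 (hT.eventually (eventually_le_nhds hε))
  exact ⟨N, fun n hn hMn Q hQ => (main n M hMn (α n) (hα n) Q hQ).trans (hN n hn)⟩
end

section
/- Fix reals γ_h, γ_u, γ_v, γ_Q > 0, sequences H, U, V : ℕ → ℂ with |H_i| ≤ γ_h, |U_i| ≤ γ_u, |V_i| ≤ γ_v for all i, and bounds γ_i ∈ (0, γ_Q]. Define ψ^o(n) := inf_{Q ∈ 𝒬^α(n)} ‖T_n Φ(Q)‖ and μ_n := inf{ ‖diag(H_1,…,H_n) − diag(U_1,…,U_n)·Z·diag(V_1,…,V_n)‖ : Z an n×n complex matrix with |Z_{ii}| ≤ γ_i }. Then for every n and every α ≥ 0, ψ^o(n) ≤ μ_n; that is, a diagonal (decentralized) choice of Q achieves total social cost at most the minimal total individual cost. -/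
/-- The deviation-from-average matrix `T_n = I_n − (1/n) 𝟙𝟙ᵀ`. -/
noncomputable def Tmat (n : ℕ) : Matrix (Fin n) (Fin n) ℂ :=
  1 - ((n : ℂ)⁻¹) • Matrix.of (fun _ _ : Fin n => (1 : ℂ))

/-- `μ_n`: the minimal total individual cost,
`inf { ‖diag(H₁,…,H_n) − diag(U₁,…,U_n) Z diag(V₁,…,V_n)‖ : |Z_{ii}| ≤ γ i }`. -/
noncomputable def muSeq (H U V : ℕ → ℂ) (γ : ℕ → ℝ) (M : ℕ) : ℝ :=
  sInf {r : ℝ | ∃ Z : Matrix (Fin M) (Fin M) ℂ, (∀ i, ‖Z i i‖ ≤ γ (i : ℕ)) ∧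
    r = l2opNorm (Matrix.diagonal (fun i : Fin M => H i) -
      Matrix.diagonal (fun i : Fin M => U i) * Z * Matrix.diagonal (fun i : Fin M => V i))}

open scoped Matrix.Norms.L2Operator in
theorem l2opNorm_eq_norm {n : ℕ} (A : Matrix (Fin n) (Fin n) ℂ) : l2opNorm A = ‖A‖ := rfl

theorem Tmat_isSelfAdjoint (n : ℕ) : IsSelfAdjoint (Tmat n) := by
  ext i j
  simp [Tmat, Matrix.star_apply, Matrix.one_apply, eq_comm]

theorem Tmat_idem (n : ℕ) : Tmat n * Tmat n = Tmat n := by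
  rcases Nat.eq_zero_or_pos n with rfl | hn
  · ext i; exact i.elim0
  have hn' : (n : ℂ) ≠ 0 := by exact_mod_cast hn.ne'
  have hJ : (Matrix.of (fun _ _ : Fin n => (1 : ℂ))) * Matrix.of (fun _ _ : Fin n => (1 : ℂ))
      = (n : ℂ) • Matrix.of (fun _ _ : Fin n => (1 : ℂ)) := by
    ext i j; simp [Matrix.mul_apply]
  simp only [Tmat, sub_mul, mul_sub, one_mul, mul_one, Matrix.smul_mul, Matrix.mul_smul, hJ,
    smul_smul]
  rw [inv_mul_cancel₀ hn', mul_one, sub_self, sub_zero]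

open scoped Matrix.Norms.L2Operator in
theorem Tmat_norm_le (n : ℕ) : ‖Tmat n‖ ≤ 1 := by
  have h : ‖star (Tmat n) * Tmat n‖ = ‖Tmat n‖ * ‖Tmat n‖ := CStarRing.norm_star_mul_self
  rw [(Tmat_isSelfAdjoint n).star_eq, Tmat_idem] at h
  nlinarith [norm_nonneg (Tmat n)]

open scoped Matrix.Norms.L2Operator in
theorem norm_entry_le {n : ℕ} (A : Matrix (Fin n) (Fin n) ℂ) (i : Fin n) : ‖A i i‖ ≤ ‖A‖ := by
  have h := Matrix.l2_opNorm_mulVec A (EuclideanSpace.single i (1 : ℂ))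
  have h2 := PiLp.norm_apply_le
    (WithLp.toLp 2 (A.mulVec (EuclideanSpace.single i (1 : ℂ)).ofLp) : EuclideanSpace ℂ (Fin n)) i
  have h3 := h2.trans h
  simpa using h3

open scoped Matrix.Norms.L2Operator in
theorem norm_key (H U V : ℕ → ℂ) (n : ℕ) (Z : Matrix (Fin n) (Fin n) ℂ) :
    l2opNorm (Tmat n * PhiMat n H U V (Matrix.diagonal fun i => Z i i)) ≤
      l2opNorm (PhiMat n H U V Z) := by
  rw [l2opNorm_eq_norm, l2opNorm_eq_norm]
  have h1 : ‖PhiMat n H U V (Matrix.diagonal fun i => Z i i)‖ ≤ ‖PhiMat n H U V Z‖ := by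
    have e : PhiMat n H U V (Matrix.diagonal fun i => Z i i) =
        Matrix.diagonal (fun i => PhiMat n H U V Z i i) := by
      simp [PhiMat, Matrix.diagonal_mul_diagonal, Matrix.diagonal_sub]
    rw [e, Matrix.l2_opNorm_diagonal]
    exact (pi_norm_le_iff_of_nonneg (norm_nonneg _)).2 fun i => norm_entry_le _ i
  have h2 := Matrix.l2_opNorm_mul (Tmat n) (PhiMat n H U V (Matrix.diagonal fun i => Z i i))
  have h3 := mul_le_mul_of_nonneg_right (Tmat_norm_le n)
    (norm_nonneg (PhiMat n H U V (Matrix.diagonal fun i => Z i i)))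
  rw [one_mul] at h3
  exact h2.trans (h3.trans h1)

/-- for every `n` and every `α ≥ 0`, the optimal social cost
`ψ^o(n) = inf_{Q ∈ 𝒬^α(n)} ‖T_n Φ(Q)‖` is at most the minimal total individual cost `μ_n`. -/
theorem social_cost_le_individual_cost
    (H U V : ℕ → ℂ) (γ : ℕ → ℝ) (hγ : ∀ i, 0 < γ i)
    (n : ℕ) (α : ℝ) (hα : 0 ≤ α) :
    sInf {r : ℝ | ∃ Q ∈ QSet n α γ, r = l2opNorm (Tmat n * PhiMat n H U V Q)} ≤
      muSeq H U V γ n := by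
  unfold muSeq
  refine le_csInf ⟨_, 0, fun i => by simpa using (hγ i).le, rfl⟩ ?_
  rintro r ⟨Z, hZ, rfl⟩
  refine le_trans (csInf_le ?_ ?_) (norm_key H U V n Z)
  · refine ⟨0, ?_⟩
    rintro _ ⟨Q, _, rfl⟩
    exact norm_nonneg _
  refine ⟨Matrix.diagonal fun i => Z i i, ⟨fun j => ?_, fun i => ?_⟩, rfl⟩
  · rw [Finset.sum_eq_zero]
    · positivity
    · intro i hi
      simp [Matrix.diagonal_apply_ne _ (Finset.ne_of_mem_erase hi)]
  · simpa using hZ i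
end

section
/- (Lemma 2, matrix formalization.) Fix reals γ_h, γ_u, γ_v, γ_Q > 0, sequences H, U, V : ℕ → ℂ with |H_i| ≤ γ_h, |U_i| ≤ γ_u, |V_i| ≤ γ_v for all i, and bounds γ_i ∈ (0, γ_Q]. Then for every n, every α ≥ 0, and every Q ∈ 𝒬^α(n): (1/√n)·‖(1/n)𝟙𝟙^⊤Φ(Q)‖_F ≤ (γ_h + (1+α)γ_u γ_Q γ_v)/√n. Consequently, if α = α(n) satisfies α(n)/√n → 0 as n → ∞, then (1/√n)‖(1/n)𝟙𝟙^⊤Φ(Q)‖_F → 0 uniformly over Q ∈ 𝒬^{α(n)}(n). -/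
/-- The Frobenius norm of a complex matrix. -/
noncomputable def frobNorm {m n : Type*} [Fintype m] [Fintype n] (A : Matrix m n ℂ) : ℝ :=
  Real.sqrt (∑ i, ∑ j, ‖A i j‖ ^ 2)

lemma avg_entry_bound_aux
    (γh γu γv γQ : ℝ) (hγu : 0 < γu) (hγv : 0 < γv)
    (H U V : ℕ → ℂ)
    (hH : ∀ i, ‖H i‖ ≤ γh) (hU : ∀ i, ‖U i‖ ≤ γu)
    (hV : ∀ i, ‖V i‖ ≤ γv)
    (γ : ℕ → ℝ) (hγQ' : ∀ i, γ i ≤ γQ)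
    (n : ℕ) (α : ℝ) (hα : 0 ≤ α) (Q : Matrix (Fin n) (Fin n) ℂ) (hQ : Q ∈ QSet n α γ)
    (i j : Fin n) :
    ‖avgMat n (PhiMat n H U V Q) i j‖ ≤ (n : ℝ)⁻¹ * (γh + (1 + α) * γu * γQ * γv) := by
  have e : avgMat n (PhiMat n H U V Q) i j
      = (n : ℂ)⁻¹ * (H j - ∑ k : Fin n, U k * Q k j * V j) := by
    simp only [avgMat, PhiMat, Matrix.mul_apply, Matrix.smul_apply, Matrix.of_apply,
      Matrix.sub_apply, Matrix.mul_diagonal, Matrix.diagonal_mul, smul_eq_mul, mul_one,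
      ← Finset.mul_sum, Finset.sum_sub_distrib, Matrix.diagonal_apply]
    simp
  have hcol : ∑ k : Fin n, ‖Q k j‖ ≤ (1 + α) * γQ := by
    rw [← Finset.add_sum_erase _ _ (Finset.mem_univ j)]
    have h1 := hQ.1 j
    have h2 := (hQ.2 j).trans (hγQ' j)
    nlinarith [mul_le_mul_of_nonneg_left h2 hα]
  have hsum : ‖∑ k : Fin n, U k * Q k j * V j‖ ≤ (1 + α) * γu * γQ * γv := by
    calc ‖∑ k : Fin n, U k * Q k j * V j‖ ≤ ∑ k : Fin n, γu * ‖Q k j‖ * γv := by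
          refine norm_sum_le_of_le _ fun k _ => ?_
          rw [norm_mul, norm_mul]
          have := hU k
          have := hV j
          gcongr
      _ = γu * (∑ k : Fin n, ‖Q k j‖) * γv := by
          rw [Finset.mul_sum, Finset.sum_mul]
      _ ≤ γu * ((1 + α) * γQ) * γv := by gcongr
      _ = _ := by ring
  rw [e, norm_mul, norm_inv, Complex.norm_natCast]
  gcongr
  exact (norm_sub_le _ _).trans (add_le_add (hH j) hsum)

lemma frob_bound_aux (n : ℕ) (C : ℝ) (hC : 0 ≤ C) (A : Matrix (Fin n) (Fin n) ℂ)
    (h : ∀ i j, ‖A i j‖ ≤ (n : ℝ)⁻¹ * C) : frobNorm A ≤ C := by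
  unfold frobNorm
  apply Real.sqrt_le_iff.2 ⟨hC, ?_⟩
  calc ∑ i, ∑ j, ‖A i j‖ ^ 2 ≤ ∑ _i : Fin n, ∑ _j : Fin n, ((n : ℝ)⁻¹ * C) ^ 2 := by
        gcongr with i _ j _
        exact h i j
    _ ≤ C ^ 2 := by
        simp only [Finset.sum_const, Finset.card_univ, Fintype.card_fin, nsmul_eq_mul]
        rcases Nat.eq_zero_or_pos n with rfl | hn
        · simp; positivity
        · have : (n : ℝ) ≠ 0 := by positivity
          apply le_of_eq
          field_simp

/-- Lemma 2: for every `n`, `α ≥ 0` and `Q ∈ 𝒬^α(n)`,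
`(1/√n) ‖(1/n) 𝟙𝟙ᵀ Φ(Q)‖_F ≤ (γh + (1+α) γu γQ γv)/√n`; consequently, if `α(n)/√n → 0`
then `(1/√n) ‖(1/n) 𝟙𝟙ᵀ Φ(Q)‖_F → 0` uniformly over `Q ∈ 𝒬^{α(n)}(n)`. -/
theorem scaled_frobenius_ensemble_average_bound
    (γh γu γv γQ : ℝ) (hγh : 0 < γh) (hγu : 0 < γu) (hγv : 0 < γv) (hγQ : 0 < γQ)
    (H U V : ℕ → ℂ)
    (hH : ∀ i, ‖H i‖ ≤ γh) (hU : ∀ i, ‖U i‖ ≤ γu)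
    (hV : ∀ i, ‖V i‖ ≤ γv)
    (γ : ℕ → ℝ) (hγ : ∀ i, 0 < γ i) (hγQ' : ∀ i, γ i ≤ γQ) :
    (∀ (n : ℕ) (α : ℝ), 0 ≤ α → ∀ Q ∈ QSet n α γ,
        (1 / Real.sqrt n) * frobNorm (avgMat n (PhiMat n H U V Q)) ≤
          (γh + (1 + α) * γu * γQ * γv) / Real.sqrt n) ∧
    (∀ α : ℕ → ℝ, (∀ n, 0 ≤ α n) →
        Filter.Tendsto (fun n => α n / Real.sqrt n) Filter.atTop (nhds 0) →
        ∀ ε > (0 : ℝ), ∃ N : ℕ, ∀ n ≥ N, ∀ Q ∈ QSet n (α n) γ,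
          (1 / Real.sqrt n) * frobNorm (avgMat n (PhiMat n H U V Q)) ≤ ε) := by
  have key : ∀ (n : ℕ) (α : ℝ), 0 ≤ α → ∀ Q ∈ QSet n α γ,
        (1 / Real.sqrt n) * frobNorm (avgMat n (PhiMat n H U V Q)) ≤
          (γh + (1 + α) * γu * γQ * γv) / Real.sqrt n := by
    intro n α hα Q hQ
    rw [div_mul_eq_mul_div, one_mul]
    gcongr
    exact frob_bound_aux n _ (by positivity) _
      (avg_entry_bound_aux γh γu γv γQ hγu hγv H U V hH hU hV γ hγQ' n α hα Q hQ)
  refine ⟨key, fun α hα hlim ε hε => ?_⟩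
  have hs : Filter.Tendsto (fun n : ℕ => (Real.sqrt n)⁻¹) Filter.atTop (nhds 0) :=
    (Real.tendsto_sqrt_atTop.comp tendsto_natCast_atTop_atTop).inv_tendsto_atTop
  have ht : Filter.Tendsto (fun n : ℕ => (γh + (1 + α n) * γu * γQ * γv) / Real.sqrt n)
      Filter.atTop (nhds 0) := by
    have := (hs.const_mul (γh + γu * γQ * γv)).add (hlim.const_mul (γu * γQ * γv))
    simp only [mul_zero, add_zero] at this
    refine this.congr fun n => ?_
    ring
  obtain ⟨N, hN⟩ := Filter.eventually_atTop.1 (ht.eventually (gt_mem_nhds hε))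
  exact ⟨N, fun n hn Q hQ => (key n (α n) (hα n) Q hQ).trans (hN n hn).le⟩
end

section
/- (Theorem 2, matrix formalization.) Fix reals γ_h, γ_u, γ_v, γ_Q > 0, sequences H, U, V : ℕ → ℂ with |H_i| ≤ γ_h, |U_i| ≤ γ_u, |V_i| ≤ γ_v for all i, bounds γ_i ∈ (0, γ_Q], and a function α : ℕ → [0,∞) with α(n)/√n → 0. Define ψ₂^o(n) := inf_{Q ∈ 𝒬^{α(n)}(n)} (1/√n)‖T_n Φ(Q)‖_F and μ₂^o(n) := inf_{Q ∈ 𝒬^{α(n)}(n)} (1/√n)‖Φ(Q)‖_F. Then |ψ₂^o(n) − μ₂^o(n)| ≤ (γ_h + (1+α(n))γ_u γ_Q γ_v)/√n for every n, and hence ψ₂^o(n) − μ₂^o(n) → 0 as n → ∞. Moreover μ₂^o(n) ≤ γ_h for every n. -/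
section helpers
attribute [local instance] Matrix.frobeniusNormedAddCommGroup

theorem frobNorm_eq_norm {n : ℕ} (A : Matrix (Fin n) (Fin n) ℂ) : frobNorm A = ‖A‖ := by
  rw [Matrix.frobenius_norm_def, frobNorm, Real.sqrt_eq_rpow]
  norm_cast

theorem frobNorm_abs_sub_le {n : ℕ} (A B : Matrix (Fin n) (Fin n) ℂ) :
    |frobNorm A - frobNorm B| ≤ frobNorm (A - B) := by
  simp only [frobNorm_eq_norm]
  exact abs_norm_sub_norm_le A B

end helpers

theorem frobNorm_le_of_entry {n : ℕ} (A : Matrix (Fin n) (Fin n) ℂ) (C : ℝ) (hC : 0 ≤ C)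
    (h : ∀ i j, ‖A i j‖ ≤ C / n) : frobNorm A ≤ C := by
  unfold frobNorm
  rw [Real.sqrt_le_left hC]
  rcases Nat.eq_zero_or_pos n with rfl | hn
  · simp; positivity
  have hn' : (0 : ℝ) < n := by exact_mod_cast hn
  calc ∑ i, ∑ j, ‖A i j‖ ^ 2 ≤ ∑ _i : Fin n, ∑ _j : Fin n, (C / n) ^ 2 := by
        gcongr with i _ j _
        exact h i j
    _ = C ^ 2 := by
        simp
        field_simp

theorem PhiMat_apply (n : ℕ) (H U V : ℕ → ℂ) (Q : Matrix (Fin n) (Fin n) ℂ) (i j : Fin n) :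
    PhiMat n H U V Q i j = (if i = j then H i else 0) - U i * Q i j * V j := by
  simp [PhiMat, Matrix.diagonal_apply]

theorem colsum_le (γh γu γv γQ : ℝ) (hγu : 0 < γu) (hγv : 0 < γv)
    (H U V : ℕ → ℂ)
    (hH : ∀ i, ‖H i‖ ≤ γh) (hU : ∀ i, ‖U i‖ ≤ γu) (hV : ∀ i, ‖V i‖ ≤ γv)
    (γ : ℕ → ℝ) (hγQ' : ∀ i, γ i ≤ γQ) (a : ℝ) (ha : 0 ≤ a) (n : ℕ)
    (Q : Matrix (Fin n) (Fin n) ℂ) (hQ : Q ∈ QSet n a γ) (j : Fin n) :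
    ‖∑ k, PhiMat n H U V Q k j‖ ≤ γh + (1 + a) * γu * γQ * γv := by
  have h1 : ∑ k, ‖Q k j‖ ≤ (1 + a) * γQ := by
    rw [← Finset.add_sum_erase _ _ (Finset.mem_univ j)]
    have h2 := hQ.1 j
    have h3 := (hQ.2 j).trans (hγQ' j)
    have h4 := mul_le_mul_of_nonneg_left h3 ha
    linarith
  simp only [PhiMat_apply, Finset.sum_sub_distrib, Finset.sum_ite_eq', Finset.mem_univ, if_true]
  refine (norm_sub_le _ _).trans (add_le_add (hH j) ?_)
  calc ‖∑ k : Fin n, U k * Q k j * V j‖ ≤ ∑ k : Fin n, γu * ‖Q k j‖ * γv := by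
        refine (norm_sum_le _ _).trans (Finset.sum_le_sum fun k _ => ?_)
        rw [norm_mul, norm_mul]
        gcongr
        · exact hU k
        · exact hV j
    _ = (∑ k, ‖Q k j‖) * (γu * γv) := by
        rw [Finset.sum_mul]
        exact Finset.sum_congr rfl fun k _ => by ring
    _ ≤ ((1 + a) * γQ) * (γu * γv) := by gcongr
    _ = _ := by ring

theorem frobNorm_T_diff (γh γu γv γQ : ℝ) (hγh : 0 < γh) (hγu : 0 < γu) (hγv : 0 < γv)
    (hγQ : 0 < γQ) (H U V : ℕ → ℂ)
    (hH : ∀ i, ‖H i‖ ≤ γh) (hU : ∀ i, ‖U i‖ ≤ γu) (hV : ∀ i, ‖V i‖ ≤ γv)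
    (γ : ℕ → ℝ) (hγQ' : ∀ i, γ i ≤ γQ) (a : ℝ) (ha : 0 ≤ a) (n : ℕ)
    (Q : Matrix (Fin n) (Fin n) ℂ) (hQ : Q ∈ QSet n a γ) :
    |frobNorm (Tmat n * PhiMat n H U V Q) - frobNorm (PhiMat n H U V Q)| ≤
      γh + (1 + a) * γu * γQ * γv := by
  rw [abs_sub_comm]
  refine (frobNorm_abs_sub_le _ _).trans (frobNorm_le_of_entry _ _ (by positivity) fun i j => ?_)
  have h : (PhiMat n H U V Q - Tmat n * PhiMat n H U V Q) i j
      = (n : ℂ)⁻¹ * ∑ k, PhiMat n H U V Q k j := by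
    simp [Tmat, sub_mul, Matrix.mul_apply, Finset.mul_sum]
  rw [h, norm_mul, norm_inv, Complex.norm_natCast, div_eq_inv_mul]
  gcongr
  exact colsum_le γh γu γv γQ hγu hγv H U V hH hU hV γ hγQ' a ha n Q hQ j

theorem frobNorm_nonneg' {n : ℕ} (A : Matrix (Fin n) (Fin n) ℂ) : 0 ≤ frobNorm A :=
  Real.sqrt_nonneg _

theorem zero_mem_QSet (n : ℕ) (a : ℝ) (γ : ℕ → ℝ) (hγ : ∀ i, 0 < γ i) :
    (0 : Matrix (Fin n) (Fin n) ℂ) ∈ QSet n a γ := by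
  refine ⟨fun j => by simp, fun i => by simpa using (hγ i).le⟩

theorem sInf_le_sInf_add {ι : Type*} (S : Set ι) (hS : S.Nonempty) (f g : ι → ℝ)
    (hf : ∀ q, 0 ≤ f q) (C : ℝ) (h : ∀ q ∈ S, f q ≤ g q + C) :
    sInf {r : ℝ | ∃ Q ∈ S, r = f Q} ≤ sInf {r : ℝ | ∃ Q ∈ S, r = g Q} + C := by
  rw [← sub_le_iff_le_add]
  obtain ⟨q, hq⟩ := hS
  refine le_csInf ⟨_, q, hq, rfl⟩ ?_
  rintro r ⟨p, hp, rfl⟩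
  have : sInf {r : ℝ | ∃ Q ∈ S, r = f Q} ≤ f p :=
    csInf_le ⟨0, by rintro r ⟨p, _, rfl⟩; exact hf p⟩ ⟨p, hp, rfl⟩
  linarith [h p hp]

/-- Theorem 2: the scaled-`H₂` optimal social cost
`ψ₂^o(n) = inf_{Q ∈ 𝒬^{α(n)}(n)} (1/√n) ‖T_n Φ(Q)‖_F` and the scaled-`H₂` optimal individual
cost `μ₂^o(n) = inf_{Q ∈ 𝒬^{α(n)}(n)} (1/√n) ‖Φ(Q)‖_F` satisfy
`|ψ₂^o(n) − μ₂^o(n)| ≤ (γh + (1+α(n)) γu γQ γv)/√n`, hence `ψ₂^o(n) − μ₂^o(n) → 0`;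
moreover `μ₂^o(n) ≤ γh` for every `n`. -/
theorem decentralized_selfish_optimal_H2
    (γh γu γv γQ : ℝ) (hγh : 0 < γh) (hγu : 0 < γu) (hγv : 0 < γv) (hγQ : 0 < γQ)
    (H U V : ℕ → ℂ)
    (hH : ∀ i, ‖H i‖ ≤ γh) (hU : ∀ i, ‖U i‖ ≤ γu)
    (hV : ∀ i, ‖V i‖ ≤ γv)
    (γ : ℕ → ℝ) (hγ : ∀ i, 0 < γ i) (hγQ' : ∀ i, γ i ≤ γQ)
    (α : ℕ → ℝ) (hα : ∀ n, 0 ≤ α n)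
    (hαn : Filter.Tendsto (fun n => α n / Real.sqrt n) Filter.atTop (nhds 0)) :
    (∀ n : ℕ,
      |sInf {r : ℝ | ∃ Q ∈ QSet n (α n) γ,
          r = (1 / Real.sqrt n) * frobNorm (Tmat n * PhiMat n H U V Q)} -
        sInf {r : ℝ | ∃ Q ∈ QSet n (α n) γ,
          r = (1 / Real.sqrt n) * frobNorm (PhiMat n H U V Q)}| ≤
        (γh + (1 + α n) * γu * γQ * γv) / Real.sqrt n) ∧
    Filter.Tendsto
      (fun n => sInf {r : ℝ | ∃ Q ∈ QSet n (α n) γ,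
          r = (1 / Real.sqrt n) * frobNorm (Tmat n * PhiMat n H U V Q)} -
        sInf {r : ℝ | ∃ Q ∈ QSet n (α n) γ,
          r = (1 / Real.sqrt n) * frobNorm (PhiMat n H U V Q)})
      Filter.atTop (nhds 0) ∧
    (∀ n : ℕ,
      sInf {r : ℝ | ∃ Q ∈ QSet n (α n) γ,
          r = (1 / Real.sqrt n) * frobNorm (PhiMat n H U V Q)} ≤ γh) := by
  have key : ∀ n : ℕ,
      |sInf {r : ℝ | ∃ Q ∈ QSet n (α n) γ,
          r = (1 / Real.sqrt n) * frobNorm (Tmat n * PhiMat n H U V Q)} -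
        sInf {r : ℝ | ∃ Q ∈ QSet n (α n) γ,
          r = (1 / Real.sqrt n) * frobNorm (PhiMat n H U V Q)}| ≤
        (γh + (1 + α n) * γu * γQ * γv) / Real.sqrt n := by
    intro n
    have hb : ∀ Q ∈ QSet n (α n) γ,
        |(1 / Real.sqrt n) * frobNorm (Tmat n * PhiMat n H U V Q) -
          (1 / Real.sqrt n) * frobNorm (PhiMat n H U V Q)| ≤
        (γh + (1 + α n) * γu * γQ * γv) / Real.sqrt n := by
      intro Q hQ
      rw [← mul_sub, abs_mul, abs_of_nonneg (by positivity : 0 ≤ 1 / Real.sqrt (n : ℝ)),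
        div_eq_mul_one_div (γh + (1 + α n) * γu * γQ * γv) (Real.sqrt n),
        mul_comm (γh + (1 + α n) * γu * γQ * γv)]
      refine mul_le_mul_of_nonneg_left ?_ (by positivity)
      exact frobNorm_T_diff γh γu γv γQ hγh hγu hγv hγQ H U V hH hU hV γ hγQ' _ (hα n) n Q hQ
    have hne : (QSet n (α n) γ).Nonempty := ⟨0, zero_mem_QSet n _ γ hγ⟩
    have h1 := sInf_le_sInf_add (QSet n (α n) γ) hne
      (fun Q => (1 / Real.sqrt n) * frobNorm (Tmat n * PhiMat n H U V Q))
      (fun Q => (1 / Real.sqrt n) * frobNorm (PhiMat n H U V Q))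
      (fun Q => mul_nonneg (by positivity) (frobNorm_nonneg' _))
      ((γh + (1 + α n) * γu * γQ * γv) / Real.sqrt n)
      (fun Q hQ => by have := (abs_le.1 (hb Q hQ)).2; linarith)
    have h2 := sInf_le_sInf_add (QSet n (α n) γ) hne
      (fun Q => (1 / Real.sqrt n) * frobNorm (PhiMat n H U V Q))
      (fun Q => (1 / Real.sqrt n) * frobNorm (Tmat n * PhiMat n H U V Q))
      (fun Q => mul_nonneg (by positivity) (frobNorm_nonneg' _))
      ((γh + (1 + α n) * γu * γQ * γv) / Real.sqrt n)
      (fun Q hQ => by have := (abs_le.1 (hb Q hQ)).1; linarith)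
    rw [abs_le]
    constructor <;> linarith
  refine ⟨key, ?_, ?_⟩
  · refine squeeze_zero_norm (fun n => key n) ?_
    have hs : Filter.Tendsto (fun n : ℕ => (γh + γu * γQ * γv) / Real.sqrt n)
        Filter.atTop (nhds 0) :=
      Filter.Tendsto.div_atTop tendsto_const_nhds
        (Real.tendsto_sqrt_atTop.comp tendsto_natCast_atTop_atTop)
    have ht := hs.add (hαn.mul_const (γu * γQ * γv))
    rw [zero_mul, add_zero] at ht
    refine ht.congr fun n => ?_
    ring
  · intro n
    refine le_trans (b := (1 / Real.sqrt n) * frobNorm (PhiMat n H U V 0))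
      (csInf_le ⟨0, ?_⟩ ⟨0, zero_mem_QSet n _ γ hγ, rfl⟩) ?_
    · rintro r ⟨p, _, rfl⟩
      exact mul_nonneg (by positivity) (frobNorm_nonneg' _)
    have h : frobNorm (PhiMat n H U V 0) ≤ Real.sqrt n * γh := by
      unfold frobNorm
      rw [Real.sqrt_le_left (by positivity), mul_pow, Real.sq_sqrt (by positivity)]
      calc ∑ i, ∑ j, ‖PhiMat n H U V 0 i j‖ ^ 2 ≤ ∑ _i : Fin n, γh ^ 2 := by
            refine Finset.sum_le_sum fun i _ => ?_
            rw [Finset.sum_eq_single i]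
            · simp only [PhiMat_apply]
              simpa using pow_le_pow_left₀ (norm_nonneg _) (hH i) 2
            · intro j _ hj
              simp [PhiMat_apply, hj.symm]
            · simp
        _ = n * γh ^ 2 := by simp
    rcases Nat.eq_zero_or_pos n with rfl | hn
    · simpa using hγh.le
    have hn' : (0 : ℝ) < Real.sqrt n := Real.sqrt_pos.2 (by exact_mod_cast hn)
    rw [one_div, inv_mul_le_iff₀ hn']
    exact h
end

section
/- (Theorem 3, matrix formalization.) Fix reals γ_h, γ_u, γ_v, γ_Q > 0, sequences H, U, V : ℕ → ℂ with |H_i| ≤ γ_h, |U_i| ≤ γ_u, |V_i| ≤ γ_v for all i, bounds γ_i ∈ (0, γ_Q], and a function α : ℕ → [0,∞) with α(n)/√n → 0. Define the two-block costs ψ^o(n) := inf_{Q ∈ 𝒬^{α(n)}(n)} ‖[T_n Φ(Q); Q]‖ and μ_M := inf{ ‖[diag(H_1,…,H_M) − diag(U_1,…,U_M)·Z·diag(V_1,…,V_M); Z]‖ : Z an M×M complex matrix with |Z_{ii}| ≤ γ_i }. Then (μ_M) is nondecreasing, bounded above by γ_h, and lim_{n→∞} ψ^o(n) exists and equals μ^o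 := lim_{M→∞} μ_M. -/
/-- `μ_M` for the two-block problem:
`inf { ‖[diag(H) − diag(U) Z diag(V); Z]‖ : Z an M × M matrix, |Z_{ii}| ≤ γ i }`. -/
noncomputable def muSeq2 (H U V : ℕ → ℂ) (γ : ℕ → ℝ) (M : ℕ) : ℝ :=
  sInf {r : ℝ | ∃ Z : Matrix (Fin M) (Fin M) ℂ, (∀ i, ‖Z i i‖ ≤ γ (i : ℕ)) ∧
    r = l2opNorm (Matrix.fromRows
      (Matrix.diagonal (fun i : Fin M => H i) -
        Matrix.diagonal (fun i : Fin M => U i) * Z * Matrix.diagonal (fun i : Fin M => V i)) Z)}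

lemma l2_le {m n : Type*} [Fintype m] [Fintype n] [DecidableEq n] (A : Matrix m n ℂ) (C : ℝ)
    (hC : 0 ≤ C) (h : ∀ x : n → ℂ, ∑ i, ‖(A.mulVec x) i‖ ^ 2 ≤ C ^ 2 * ∑ j, ‖x j‖ ^ 2) :
    l2opNorm A ≤ C := by
  unfold l2opNorm
  refine ContinuousLinearMap.opNorm_le_bound _ hC fun x => ?_
  refine le_of_sq_le_sq ?_ (by positivity)
  rw [mul_pow, EuclideanSpace.norm_sq_eq, EuclideanSpace.norm_sq_eq]
  simpa [Matrix.toLpLin_apply] using h x.ofLp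

lemma l2_col {m n : Type*} [Fintype m] [Fintype n] [DecidableEq n] (A : Matrix m n ℂ) (j : n) :
    ∑ i, ‖A i j‖ ^ 2 ≤ l2opNorm A ^ 2 := by
  have h := (LinearMap.toContinuousLinearMap (Matrix.toEuclideanLin A)).le_opNorm
    (EuclideanSpace.single j (1 : ℂ))
  have h2 := pow_le_pow_left₀ (norm_nonneg _) h 2
  rw [mul_pow, EuclideanSpace.norm_sq_eq] at h2
  simpa [Matrix.toLpLin_apply, l2opNorm] using h2

lemma l2_nonneg {m n : Type*} [Fintype m] [Fintype n] [DecidableEq n] (A : Matrix m n ℂ) :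
    0 ≤ l2opNorm A := norm_nonneg _

lemma T_mulVec (n : ℕ) (y : Fin n → ℂ) (i : Fin n) :
    (Tmat n).mulVec y i = y i - (n : ℂ)⁻¹ * ∑ k, y k := by
  simp [Tmat, Matrix.mulVec, dotProduct, sub_mul, Finset.sum_sub_distrib, ← Finset.mul_sum,
    Matrix.one_apply]

lemma T_norm (n : ℕ) (y : Fin n → ℂ) :
    ∑ i, ‖(Tmat n).mulVec y i‖ ^ 2 = ∑ i, ‖y i‖ ^ 2 - ‖∑ k, y k‖ ^ 2 / n := by
  rcases Nat.eq_zero_or_pos n with rfl | hn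
  · simp
  have hn' : (n : ℂ) ≠ 0 := by exact_mod_cast hn.ne'
  simp only [T_mulVec]
  apply Complex.ofReal_injective
  push_cast
  simp only [← Complex.conj_mul', map_sub, map_mul, map_inv₀, Complex.conj_natCast, map_sum]
  set s := ∑ k, y k with hs
  set t := ∑ k, (starRingEnd ℂ) (y k) with ht
  have : ∀ i, ((starRingEnd ℂ) (y i) - (n : ℂ)⁻¹ * t) * (y i - (n : ℂ)⁻¹ * s) =
     (starRingEnd ℂ) (y i) * y i - (n : ℂ)⁻¹ * s * (starRingEnd ℂ) (y i) - (n : ℂ)⁻¹ * t * y i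
      + (n : ℂ)⁻¹ * t * ((n : ℂ)⁻¹ * s) := fun i => by ring
  simp only [this, Finset.sum_add_distrib, Finset.sum_sub_distrib, ← Finset.mul_sum, ← hs, ← ht]
  simp
  field_simp
  ring

lemma diag_le {n : ℕ} (T : Matrix (Fin n) (Fin n) ℂ)
    (hT : ∀ y : Fin n → ℂ, ∑ i, ‖T.mulVec y i‖ ^ 2 ≤ ∑ i, ‖y i‖ ^ 2)
    (a b : Fin n → ℂ) (C : ℝ) (hC : 0 ≤ C) (h : ∀ i, ‖a i‖ ^ 2 + ‖b i‖ ^ 2 ≤ C ^ 2) :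
    l2opNorm (Matrix.fromRows (T * Matrix.diagonal a) (Matrix.diagonal b)) ≤ C := by
  refine l2_le _ _ hC fun x => ?_
  rw [Matrix.fromRows_mulVec, Fintype.sum_sum_type]
  simp only [Sum.elim_inl, Sum.elim_inr, ← Matrix.mulVec_mulVec]
  refine (add_le_add_left (hT _) _).trans ?_
  rw [← Finset.sum_add_distrib, Finset.mul_sum]
  refine Finset.sum_le_sum fun i _ => ?_
  simp only [Matrix.mulVec_diagonal, norm_mul, mul_pow]
  nlinarith [h i, sq_nonneg ‖x i‖]

/-- Theorem 3: the two-block `μ_M` is nondecreasing and bounded above by `γh`,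
and the two-block optimal social cost `ψ^o(n) = inf_{Q ∈ 𝒬^{α(n)}(n)} ‖[T_n Φ(Q); Q]‖`
converges, as `n → ∞`, to `μ^o = lim_M μ_M = sup_M μ_M`. -/
theorem two_block_Hinf_theorem
    (γh γu γv γQ : ℝ) (hγh : 0 < γh) (hγu : 0 < γu) (hγv : 0 < γv) (hγQ : 0 < γQ)
    (H U V : ℕ → ℂ)
    (hH : ∀ i, ‖H i‖ ≤ γh) (hU : ∀ i, ‖U i‖ ≤ γu)
    (hV : ∀ i, ‖V i‖ ≤ γv)
    (γ : ℕ → ℝ) (hγ : ∀ i, 0 < γ i) (hγQ' : ∀ i, γ i ≤ γQ)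
    (α : ℕ → ℝ) (hα : ∀ n, 0 ≤ α n)
    (hαn : Filter.Tendsto (fun n => α n / Real.sqrt n) Filter.atTop (nhds 0)) :
    Monotone (muSeq2 H U V γ) ∧ (∀ M, muSeq2 H U V γ M ≤ γh) ∧
    Filter.Tendsto
      (fun n => sInf {r : ℝ | ∃ Q ∈ QSet n (α n) γ,
        r = l2opNorm (Matrix.fromRows (Tmat n * PhiMat n H U V Q) Q)})
      Filter.atTop (nhds (⨆ M, muSeq2 H U V γ M)) := by
  let f : ℕ → ℂ → ℝ := fun i w => ‖H i - U i * w * V i‖ ^ 2 + ‖w‖ ^ 2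
  have hz : ∀ i, ∃ z : ℂ, ‖z‖ ≤ γ i ∧ ∀ w : ℂ, ‖w‖ ≤ γ i → f i z ≤ f i w := by
    intro i
    obtain ⟨z, hz, hm⟩ := (isCompact_closedBall (0 : ℂ) (γ i)).exists_isMinOn
      ⟨0, by simpa using (hγ i).le⟩ (f := f i) (by fun_prop)
    exact ⟨z, by simpa using hz, fun w hw => hm (by simpa using hw)⟩
  choose z hzγ hzmin using hz
  have hdiag : ∀ n : ℕ, Matrix.diagonal (fun i : Fin n => H i) -
      Matrix.diagonal (fun i : Fin n => U i) * Matrix.diagonal (fun i : Fin n => z i) *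
        Matrix.diagonal (fun i : Fin n => V i) =
      Matrix.diagonal (fun i : Fin n => H i - U i * z i * V i) := by
    intro n
    rw [Matrix.diagonal_mul_diagonal, Matrix.diagonal_mul_diagonal, Matrix.diagonal_sub]
  have hent : ∀ (n : ℕ) (Q : Matrix (Fin n) (Fin n) ℂ) (k j : Fin n),
      (Matrix.diagonal (fun i : Fin n => H i) -
      Matrix.diagonal (fun i : Fin n => U i) * Q * Matrix.diagonal (fun i : Fin n => V i)) k j =
      (if k = j then H k else 0) - U k * Q k j * V j := by
    intro n Q k j
    rw [Matrix.sub_apply, Matrix.mul_diagonal, Matrix.diagonal_mul, Matrix.diagonal_apply]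
  have hcol : ∀ (n : ℕ) (Q : Matrix (Fin n) (Fin n) ℂ) (j : Fin n), ‖Q j j‖ ≤ γ j →
      f j (z j) ≤ ∑ k, ‖(Matrix.diagonal (fun i : Fin n => H i) -
      Matrix.diagonal (fun i : Fin n => U i) * Q *
        Matrix.diagonal (fun i : Fin n => V i)) k j‖ ^ 2 + ∑ k, ‖Q k j‖ ^ 2 := by
    intro n Q j hj
    refine (hzmin j _ hj).trans ?_
    refine add_le_add ?_ ?_
    · refine le_trans (le_of_eq ?_) (Finset.single_le_sum (fun i _ => sq_nonneg _)
        (Finset.mem_univ j))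
      rw [hent]; simp
    · exact Finset.single_le_sum (f := fun k => ‖Q k j‖ ^ 2) (fun i _ => sq_nonneg _)
        (Finset.mem_univ j)
  -- properties of μ
  have mu_nonneg : ∀ M, 0 ≤ muSeq2 H U V γ M := by
    intro M
    refine Real.sInf_nonneg ?_
    rintro r ⟨Z, _, rfl⟩
    exact l2_nonneg _
  have mu_lb : ∀ M i, i < M → f i (z i) ≤ muSeq2 H U V γ M ^ 2 := by
    intro M i hi
    have : √(f i (z i)) ≤ muSeq2 H U V γ M := by
      refine le_csInf ⟨_, Matrix.diagonal (fun i : Fin M => z i), ?_, rfl⟩ ?_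
      · intro i; simpa using hzγ i
      · rintro r ⟨Z, hZ, rfl⟩
        refine Real.sqrt_le_iff.2 ⟨l2_nonneg _, ?_⟩
        refine le_trans (hcol M Z ⟨i, hi⟩ (hZ _)) ?_
        refine le_trans (le_of_eq ?_) (l2_col _ (⟨i, hi⟩ : Fin M))
        rw [Fintype.sum_sum_type]
        simp only [Matrix.fromRows_apply_inl, Matrix.fromRows_apply_inr]
    exact (Real.sqrt_le_iff.1 this).2
  have mu_ub : ∀ M C, 0 ≤ C → (∀ i < M, f i (z i) ≤ C ^ 2) → muSeq2 H U V γ M ≤ C := by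
    intro M C hC h
    unfold muSeq2
    refine le_trans (csInf_le ?_ (Set.mem_setOf.2 ⟨Matrix.diagonal (fun i : Fin M => z i), ?_, rfl⟩)) ?_
    · refine ⟨0, ?_⟩
      rintro r ⟨Z, _, rfl⟩
      exact l2_nonneg _
    · intro i; simpa using hzγ i
    · rw [hdiag]
      have := diag_le (1 : Matrix (Fin M) (Fin M) ℂ) (by simp)
        (fun i => H i - U i * z i * V i) (fun i => z i) C hC (fun i => h i i.2)
      simpa using this
  have mono : Monotone (muSeq2 H U V γ) := fun M N hMN =>
    mu_ub M _ (mu_nonneg N) fun i hi => mu_lb N i (hi.trans_le hMN)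
  have bdd : ∀ M, muSeq2 H U V γ M ≤ γh := fun M => mu_ub M _ hγh.le fun i _ => by
    refine (hzmin i 0 (by simpa using (hγ i).le)).trans ?_
    simpa [f] using pow_le_pow_left₀ (norm_nonneg _) (hH i) 2
  refine ⟨mono, bdd, ?_⟩
  have lim : Filter.Tendsto (muSeq2 H U V γ) Filter.atTop (nhds (⨆ M, muSeq2 H U V γ M)) :=
    tendsto_atTop_ciSup mono ⟨γh, by rintro _ ⟨M, rfl⟩; exact bdd M⟩
  let e : ℕ → ℝ := fun n => (γh + γu * γv * ((1 + α n) * γQ)) / √n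
  have he : Filter.Tendsto e Filter.atTop (nhds 0) := by
    have h1 : Filter.Tendsto (fun n : ℕ => (√n)⁻¹) Filter.atTop (nhds 0) :=
      (Real.tendsto_sqrt_atTop.comp tendsto_natCast_atTop_atTop).inv_tendsto_atTop
    have h2 := (h1.const_mul (γh + γu * γv * γQ)).add (hαn.const_mul (γu * γv * γQ))
    simp only [mul_zero, add_zero] at h2
    refine h2.congr fun n => ?_
    simp only [e]; ring
  have he0 : ∀ n, 0 ≤ e n := fun n => by
    have := hα n
    simp only [e]; positivity
  have lim' := lim.sub he
  rw [sub_zero] at lim'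
  have hzQ : ∀ n, Matrix.diagonal (fun i : Fin n => z i) ∈ QSet n (α n) γ := by
    intro n
    refine ⟨fun j => ?_, fun i => by simpa using hzγ i⟩
    rw [Finset.sum_eq_zero]
    · exact mul_nonneg (hα n) (norm_nonneg _)
    · intro i hi
      rw [Matrix.diagonal_apply_ne _ (Finset.ne_of_mem_erase hi), norm_zero]
  refine tendsto_of_tendsto_of_tendsto_of_le_of_le lim' lim (fun n => ?_) (fun n => ?_)
  · refine le_csInf ⟨_, _, hzQ n, rfl⟩ ?_
    rintro r ⟨Q, hQ, rfl⟩
    rw [sub_le_iff_le_add]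
    set L := l2opNorm (Matrix.fromRows (Tmat n * PhiMat n H U V Q) Q) with hL
    have hL0 : 0 ≤ L := l2_nonneg _
    refine mu_ub n _ (add_nonneg hL0 (he0 n)) fun i hi => ?_
    have hn : (0 : ℝ) < n := by exact_mod_cast (Nat.zero_le i).trans_lt hi
    have hc := hcol n Q ⟨i, hi⟩ (hQ.2 _)
    have hl := l2_col (Matrix.fromRows (Tmat n * PhiMat n H U V Q) Q) ⟨i, hi⟩
    rw [Fintype.sum_sum_type] at hl
    simp only [Matrix.fromRows_apply_inl, Matrix.fromRows_apply_inr] at hl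
    have hT := T_norm n (fun k => PhiMat n H U V Q k ⟨i, hi⟩)
    have hTm : ∀ k, (Tmat n).mulVec (fun k => PhiMat n H U V Q k ⟨i, hi⟩) k =
      (Tmat n * PhiMat n H U V Q) k ⟨i, hi⟩ := fun k => rfl
    simp only [hTm] at hT
    have hs : ‖∑ k, PhiMat n H U V Q k ⟨i, hi⟩‖ ≤ γh + γu * γv * ((1 + α n) * γQ) := by
      simp only [PhiMat, hent, Finset.sum_sub_distrib]
      refine (norm_sub_le _ _).trans (add_le_add (by simpa using hH i) ?_)
      refine (norm_sum_le _ _).trans ?_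
      have h1 : ∀ k : Fin n, ‖U k * Q k ⟨i, hi⟩ * V (⟨i, hi⟩ : Fin n)‖ ≤
          γu * γv * ‖Q k ⟨i, hi⟩‖ := by
        intro k
        rw [norm_mul, norm_mul]
        calc _ ≤ γu * ‖Q k ⟨i, hi⟩‖ * γv := by
              gcongr
              · exact hU _
              · exact hV _
          _ = _ := by ring
      refine (Finset.sum_le_sum fun k _ => h1 k).trans ?_
      rw [← Finset.mul_sum]
      refine mul_le_mul_of_nonneg_left ?_ (by positivity)
      rw [← Finset.add_sum_erase _ _ (Finset.mem_univ (⟨i, hi⟩ : Fin n))]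
      have h2 := hQ.1 ⟨i, hi⟩
      have h3 : ‖Q ⟨i, hi⟩ ⟨i, hi⟩‖ ≤ γQ := (hQ.2 _).trans (hγQ' _)
      have h4 := mul_le_mul_of_nonneg_left h3 (hα n)
      linarith
    have hs2 : ‖∑ k, PhiMat n H U V Q k ⟨i, hi⟩‖ ^ 2 / n ≤ e n ^ 2 := by
      simp only [e]
      rw [div_pow, Real.sq_sqrt hn.le]
      gcongr
    have hc' : f i (z i) ≤ ∑ k, ‖PhiMat n H U V Q k ⟨i, hi⟩‖ ^ 2 + ∑ k, ‖Q k ⟨i, hi⟩‖ ^ 2 := hc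
    nlinarith [mul_nonneg hL0 (he0 n)]
  · refine le_trans (csInf_le ?_ (Set.mem_setOf.2 ⟨_, hzQ n, rfl⟩)) ?_
    · refine ⟨0, ?_⟩
      rintro r ⟨Z, _, rfl⟩
      exact l2_nonneg _
    · rw [PhiMat, hdiag]
      refine diag_le _ (fun y => ?_) _ _ _ (mu_nonneg n) (fun i => mu_lb n i i.2)
      rw [T_norm]
      have : 0 ≤ ‖∑ k, y k‖ ^ 2 / n := by positivity
      linarith
end
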